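/- arXiv:2504.03461 — 4 statements merged into one kernel-verified Lean document; each statement's English description precedes it below -/
import Mathlib

section
/- Let π be a probability measure on ℝⁿ and let σ > 0. Define p : ℝⁿ → ℝ by p(x) = ∫ exp(−‖x−μ‖²/(2σ²)) dπ(μ). Then for every x ∈ ℝⁿ: (i) 0 < p(x) < ∞; (ii) the vector-valued integrand μ ↦ μ·exp(−‖x−μ‖²/(2σ²)) is Bochner integrable with integral m(x) := ∫ μ exp(−‖x−μ‖²/(2σ²)) dπ(μ); (iii) p is differentiable at x with gradient ∇p(x) = (1/σ²)(m(x) − x·p(x)); consequently ∇(log p)(x) = (1/σ²)(m(x)/p(x) − x). (This is Tweedie's formula, the linear-SDE special case of the paper's generalised Tweedie formula, Proposition 2.4 / Remark 2.5.) -/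
open MeasureTheory

lemma aux_bound (σ t : ℝ) (hσ : 0 < σ) :
    Real.exp (-t ^ 2 / (2 * σ ^ 2)) * t ≤ 1 + σ ^ 2 / 2 := by
  have h1 : t ≤ t ^ 2 / (2 * σ ^ 2) + σ ^ 2 / 2 := by
    have : t ^ 2 / (2 * σ ^ 2) + σ ^ 2 / 2 - t = (t / σ - σ) ^ 2 / 2 := by
      field_simp
      ring
    nlinarith [sq_nonneg (t / σ - σ)]
  have h2 := Real.add_one_le_exp (t ^ 2 / (2 * σ ^ 2))
  have hu : 0 ≤ t ^ 2 / (2 * σ ^ 2) := by positivity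
  rw [neg_div, Real.exp_neg, inv_mul_le_iff₀ (Real.exp_pos _)]
  nlinarith [mul_le_mul_of_nonneg_right h2 (show 0 ≤ 1 + σ ^ 2 / 2 by positivity),
    mul_nonneg hu (sq_nonneg σ)]

/-- Tweedie's formula (linear-SDE special case of the generalised Tweedie formula,
Proposition 2.4 / Remark 2.5): for a probability measure `π` on `ℝⁿ` and `σ > 0`,
the Gaussian mixture density `p x = ∫ exp (-‖x - μ‖² / (2σ²)) dπ(μ)` is positive and finite,
the vector integrand is Bochner integrable with integral `m x`, `p` has gradient
`(1/σ²) (m x - p x • x)` at every `x`, and consequently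
`∇ log p (x) = (1/σ²) (m x / p x - x)`. -/
theorem stmt0 {n : ℕ} (π : Measure (EuclideanSpace ℝ (Fin n))) [IsProbabilityMeasure π]
    (σ : ℝ) (hσ : 0 < σ)
    (p : EuclideanSpace ℝ (Fin n) → ℝ)
    (hp : ∀ x, p x = ∫ μ, Real.exp (-‖x - μ‖ ^ 2 / (2 * σ ^ 2)) ∂π)
    (m : EuclideanSpace ℝ (Fin n) → EuclideanSpace ℝ (Fin n))
    (hm : ∀ x, m x = ∫ μ, Real.exp (-‖x - μ‖ ^ 2 / (2 * σ ^ 2)) • μ ∂π)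
    (x : EuclideanSpace ℝ (Fin n)) :
    (0 < p x ∧ Integrable (fun μ => Real.exp (-‖x - μ‖ ^ 2 / (2 * σ ^ 2))) π) ∧
    Integrable (fun μ => Real.exp (-‖x - μ‖ ^ 2 / (2 * σ ^ 2)) • μ) π ∧
    HasGradientAt p ((1 / σ ^ 2) • (m x - p x • x)) x ∧
    HasGradientAt (fun y => Real.log (p y)) ((1 / σ ^ 2) • ((p x)⁻¹ • m x - x)) x := by
  have hE : ∀ y, Continuous (fun μ : EuclideanSpace ℝ (Fin n) =>
      Real.exp (-‖y - μ‖ ^ 2 / (2 * σ ^ 2))) := fun y => by fun_prop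
  have hI : ∀ y, Integrable (fun μ => Real.exp (-‖y - μ‖ ^ 2 / (2 * σ ^ 2))) π := fun y => by
    refine Integrable.of_bound (hE y).aestronglyMeasurable 1 (ae_of_all _ fun μ => ?_)
    rw [Real.norm_eq_abs, abs_of_pos (Real.exp_pos _), Real.exp_le_one_iff, neg_div]
    have : 0 ≤ ‖y - μ‖ ^ 2 / (2 * σ ^ 2) := by positivity
    linarith
  have hB : ∀ y μ : EuclideanSpace ℝ (Fin n),
      ‖Real.exp (-‖y - μ‖ ^ 2 / (2 * σ ^ 2)) • (μ - y)‖ ≤ 1 + σ ^ 2 / 2 := fun y μ => by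
    rw [norm_smul, Real.norm_eq_abs, abs_of_pos (Real.exp_pos _), norm_sub_rev μ y]
    exact aux_bound σ _ hσ
  have hJ : Integrable (fun μ => Real.exp (-‖x - μ‖ ^ 2 / (2 * σ ^ 2)) • (μ - x)) π :=
    Integrable.of_bound (by
      have : Continuous (fun μ : EuclideanSpace ℝ (Fin n) =>
        Real.exp (-‖x - μ‖ ^ 2 / (2 * σ ^ 2)) • (μ - x)) := by fun_prop
      exact this.aestronglyMeasurable) _ (ae_of_all _ (hB x))
  have hK : Integrable (fun μ => Real.exp (-‖x - μ‖ ^ 2 / (2 * σ ^ 2)) • μ) π := by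
    refine (hJ.add ((hI x).smul_const x)).congr (ae_of_all _ fun μ => ?_)
    simp [smul_sub]
  have hpos : 0 < p x := by
    rw [hp]
    exact integral_exp_pos (hI x)
  have hint : ∫ μ, Real.exp (-‖x - μ‖ ^ 2 / (2 * σ ^ 2)) • (μ - x) ∂π = m x - p x • x := by
    rw [hm, hp, ← integral_smul_const, ← integral_sub hK ((hI x).smul_const x)]
    simp only [smul_sub]
  obtain ⟨L, hL⟩ : ∃ L : EuclideanSpace ℝ (Fin n) →L[ℝ] EuclideanSpace ℝ (Fin n) →L[ℝ] ℝ,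
      ∀ v, L v = innerSL ℝ v := ⟨innerSL ℝ, fun _ => rfl⟩
  have hLa : ∀ u v, L u v = inner ℝ u v := fun u v => by rw [hL]; rfl
  have hgrad : HasFDerivAt p (L ((1 / σ ^ 2) • (m x - p x • x))) x := by
    have hmeas : AEStronglyMeasurable (fun μ => L ((1 / σ ^ 2) •
        (Real.exp (-‖x - μ‖ ^ 2 / (2 * σ ^ 2)) • (μ - x)))) π := by
      have : Continuous (fun μ : EuclideanSpace ℝ (Fin n) => (1 / σ ^ 2) •
        (Real.exp (-‖x - μ‖ ^ 2 / (2 * σ ^ 2)) • (μ - x))) := by fun_prop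
      exact (L.continuous.comp this).aestronglyMeasurable
    have hbd : ∀ μ y : EuclideanSpace ℝ (Fin n), ‖L ((1 / σ ^ 2) •
        (Real.exp (-‖y - μ‖ ^ 2 / (2 * σ ^ 2)) • (μ - y)))‖
          ≤ (1 / σ ^ 2) * (1 + σ ^ 2 / 2) := fun μ y => by
      rw [hL, innerSL_apply_norm, norm_smul, Real.norm_eq_abs, abs_of_nonneg (by positivity)]
      exact mul_le_mul_of_nonneg_left (hB y μ) (by positivity)
    have hdiff : ∀ μ y : EuclideanSpace ℝ (Fin n),
        HasFDerivAt (fun y => Real.exp (-‖y - μ‖ ^ 2 / (2 * σ ^ 2))) (L ((1 / σ ^ 2) •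
        (Real.exp (-‖y - μ‖ ^ 2 / (2 * σ ^ 2)) • (μ - y)))) y := fun μ y => by
      have h := (((((hasFDerivAt_id y).sub_const μ).norm_sq).neg).mul_const
          (2 * σ ^ 2)⁻¹).exp
      refine (h.congr_fderiv ?_)
      ext v
      have : (inner ℝ (μ - y) v : ℝ) = - inner ℝ (y - μ) v := by
        rw [← inner_neg_left, neg_sub]
      rw [hLa, inner_smul_left, inner_smul_left, this]
      rw [inner_sub_left]
      simp [div_eq_mul_inv, inner_sub_left]
      ring
    have key := hasFDerivAt_integral_of_dominated_of_fderiv_le (μ := π) (𝕜 := ℝ)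
      (F := fun y μ => Real.exp (-‖y - μ‖ ^ 2 / (2 * σ ^ 2)))
      (F' := fun y μ => L ((1 / σ ^ 2) •
        (Real.exp (-‖y - μ‖ ^ 2 / (2 * σ ^ 2)) • (μ - y))))
      (x₀ := x) (s := Set.univ) (bound := fun _ => (1 / σ ^ 2) * (1 + σ ^ 2 / 2))
      Filter.univ_mem
      (Filter.Eventually.of_forall fun y => (hE y).aestronglyMeasurable) (hI x)
      hmeas (ae_of_all _ fun μ y _ => hbd μ y) (integrable_const _)
      (ae_of_all _ fun μ y _ => hdiff μ y)
    have e := L.integral_comp_comm (hJ.smul (1 / σ ^ 2))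
    have e2 : ∫ μ, (1 / σ ^ 2) • (Real.exp (-‖x - μ‖ ^ 2 / (2 * σ ^ 2)) • (μ - x)) ∂π
        = (1 / σ ^ 2) • (m x - p x • x) := by
      rw [integral_smul, hint]
    rw [← e2]
    rw [funext hp]
    exact key.congr_fderiv e
  have hlog := hgrad.log hpos.ne'
  refine ⟨⟨hpos, hI x⟩, hK, ?_, ?_⟩
  · rw [hasGradientAt_iff_hasFDerivAt]
    refine hgrad.congr_fderiv ?_
    rw [hL]
    rfl
  · rw [hasGradientAt_iff_hasFDerivAt]
    refine hlog.congr_fderiv ?_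
    have : (1 / σ ^ 2) • ((p x)⁻¹ • m x - x) =
        (p x)⁻¹ • ((1 / σ ^ 2) • (m x - p x • x)) := by
      rw [smul_comm, smul_sub (p x)⁻¹, smul_smul, inv_mul_cancel₀ hpos.ne', one_smul]
    rw [this]
    ext v
    rw [hL]
    change (p x)⁻¹ * inner ℝ _ v = inner ℝ _ v
    rw [inner_smul_left (r := (p x)⁻¹)]
    rfl
end

section
/- Denoising score matching has the score as its unique minimiser: Let π be a probability measure on ℝ, a ≠ 0, σ > 0, and γ = N(0,1) the standard Gaussian measure on ℝ. Let p(x) = (2πσ²)^{−1/2} ∫ exp(−(x−aμ)²/(2σ²)) dπ(μ) be the density of the law of aX₀ + σZ (X₀ ~ π, Z ~ γ independent) and let s(x) = (log p)'(x) be its score. Then ∫ (s(aμ+σz) + z/σ)² d(π⊗γ)(μ,z) < ∞, and for every measurable u : ℝ → ℝ with ∫ u(aμ+σz)² d(π⊗γ)(μ,z) < ∞ one has ∫ (u(aμ+σz) + z/σ)² d(π⊗γ)(μ,z) ≥ ∫ (s(aμ+σz) + z/σ)² d(π⊗γ)(μ,z), with equality if and only if u = s almost everywhere with respect to the law of aμ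 + σz. -/
open MeasureTheory ProbabilityTheory

lemma dsm_add3 {α : Type*} [MeasurableSpace α] (μ : Measure α) (f g h : α → ℝ)
    (hf : Integrable f μ) (hg : Integrable g μ) (hh : Integrable h μ) :
    ∫ x, (f x + g x + h x) ∂μ = ∫ x, f x ∂μ + ∫ x, g x ∂μ + ∫ x, h x ∂μ := by
  have := integral_add (hf.add hg) hh
  have h2 := integral_add hf hg
  simp only [Pi.add_apply] at this
  rw [this, h2]

lemma dsm_meas (a : ℝ) (v : NNReal) :
    Measurable (fun q : ℝ × ℝ => gaussianPDFReal (a * q.1) v q.2) := by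
  unfold gaussianPDFReal
  fun_prop

lemma dsm_law (π : Measure ℝ) [IsProbabilityMeasure π] (a σ : ℝ) (v : NNReal)
    (hv : (v : ℝ) = σ ^ 2) (hv0 : v ≠ 0) :
    Measure.map (fun q : ℝ × ℝ => (q.1, a * q.1 + σ * q.2)) (π.prod (gaussianReal 0 1))
      = (π.prod volume).withDensity
          (fun q => ENNReal.ofReal (gaussianPDFReal (a * q.1) v q.2)) := by
  have hK := (dsm_meas a v).ennreal_ofReal
  refine Measure.ext_of_lintegral _ fun f hf => ?_
  rw [lintegral_map hf (by fun_prop), lintegral_withDensity_eq_lintegral_mul _ hK hf,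
    lintegral_prod _ (by fun_prop), lintegral_prod _ (by fun_prop)]
  refine lintegral_congr fun μ => ?_
  have h1 : Measure.map (fun z => a * μ + σ * z) (gaussianReal 0 1) = gaussianReal (a * μ) v := by
    have : (fun z => a * μ + σ * z) = (fun z => a * μ + z) ∘ (fun z => σ * z) := rfl
    rw [this, ← Measure.map_map (by fun_prop) (by fun_prop), gaussianReal_map_const_mul,
      gaussianReal_map_const_add]
    congr 1
    · simp
    · ext; simp [hv]
  have h2 : ∫⁻ z, f (μ, a * μ + σ * z) ∂(gaussianReal 0 1)
      = ∫⁻ x, f (μ, x) ∂(gaussianReal (a * μ) v) := by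
    rw [← h1, lintegral_map (by fun_prop) (by fun_prop)]
  rw [h2, gaussianReal_of_var_ne_zero _ hv0,
    lintegral_withDensity_eq_lintegral_mul _ (measurable_gaussianPDF _ _) (by fun_prop)]
  rfl

lemma dsm_integrable (π : Measure ℝ) [IsProbabilityMeasure π] (a σ : ℝ) (v : NNReal)
    (hv : (v : ℝ) = σ ^ 2) (hv0 : v ≠ 0) (f : ℝ × ℝ → ℝ) (hf : Measurable f) :
    Integrable (fun q : ℝ × ℝ => f (q.1, a * q.1 + σ * q.2)) (π.prod (gaussianReal 0 1)) ↔
    Integrable (fun q : ℝ × ℝ => gaussianPDFReal (a * q.1) v q.2 * f q) (π.prod volume) := by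
  have h := integrable_map_measure (μ := π.prod (gaussianReal 0 1))
    (f := fun q : ℝ × ℝ => (q.1, a * q.1 + σ * q.2)) (g := f)
    hf.aestronglyMeasurable (by fun_prop)
  rw [dsm_law π a σ v hv hv0, integrable_withDensity_iff_integrable_smul'
    (dsm_meas a v).ennreal_ofReal (by simp)] at h
  simp only [ENNReal.toReal_ofReal (gaussianPDFReal_nonneg _ _ _), smul_eq_mul] at h
  exact h.symm

lemma dsm_integral (π : Measure ℝ) [IsProbabilityMeasure π] (a σ : ℝ) (v : NNReal)
    (hv : (v : ℝ) = σ ^ 2) (hv0 : v ≠ 0) (f : ℝ × ℝ → ℝ) (hf : Measurable f) :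
    ∫ q : ℝ × ℝ, f (q.1, a * q.1 + σ * q.2) ∂(π.prod (gaussianReal 0 1)) =
    ∫ q : ℝ × ℝ, gaussianPDFReal (a * q.1) v q.2 * f q ∂(π.prod volume) := by
  have h := integral_map (μ := π.prod (gaussianReal 0 1))
    (φ := fun q : ℝ × ℝ => (q.1, a * q.1 + σ * q.2)) (f := f)
    (by fun_prop) hf.aestronglyMeasurable
  rw [dsm_law π a σ v hv hv0, integral_withDensity_eq_integral_toReal_smul
    (dsm_meas a v).ennreal_ofReal (by simp)] at h
  simp only [ENNReal.toReal_ofReal (gaussianPDFReal_nonneg _ _ _), smul_eq_mul] at h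
  exact h.symm

/-- bounds -/
lemma dsm_bound (v : NNReal) (hv0 : v ≠ 0) : ∃ C : ℝ, ∀ m x : ℝ,
    |gaussianPDFReal m v x| ≤ C ∧ |gaussianPDFReal m v x * ((x - m) / v)| ≤ C ∧
    |gaussianPDFReal m v x * ((x - m) / v) ^ 2| ≤ C := by
  have hv : (0 : ℝ) < v := by positivity
  set c := (√(2 * Real.pi * v))⁻¹ with hc
  have hc0 : 0 ≤ c := by positivity
  have key : ∀ m x : ℝ, ∃ t e w: ℝ, 0 ≤ t ∧ 0 ≤ e ∧ e ≤ 1 ∧ t * e ≤ 1 ∧ w ^ 2 = 2 * t / v ∧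
      gaussianPDFReal m v x = c * e ∧ (x - m) / v = w := by
    intro m x
    set t := (x - m) ^ 2 / (2 * v) with ht
    have ht0 : 0 ≤ t := by positivity
    refine ⟨t, Real.exp (-t), (x - m) / v, ht0, (Real.exp_pos _).le, by simpa using ht0, ?_, ?_, ?_, rfl⟩
    · have h1 := Real.add_one_le_exp t
      have h2 : Real.exp t * Real.exp (-t) = 1 := by rw [← Real.exp_add]; simp
      nlinarith [Real.exp_pos (-t)]
    · rw [ht]; field_simp
    · rw [gaussianPDFReal, ht, neg_div]
  have h2v : 0 ≤ 2 / (v : ℝ) := by positivity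
  refine ⟨c * (1 + 2 / v), fun m x => ?_⟩
  obtain ⟨t, e, w, ht, he, he1, hte, hw, hK, hx⟩ := key m x
  simp only [hK, hx, abs_mul, abs_of_nonneg hc0, abs_of_nonneg he, mul_assoc,
    abs_of_nonneg (sq_nonneg w)]
  have hwe : e * w ^ 2 ≤ 2 / v := by
    have : e * w ^ 2 = 2 / v * (t * e) := by rw [hw]; ring
    rw [this]; nlinarith
  refine ⟨?_, ?_, ?_⟩ <;> refine mul_le_mul_of_nonneg_left ?_ hc0
  · linarith
  · have : |w| ≤ 1 + w ^ 2 := by nlinarith [sq_abs w, sq_nonneg (|w| - 1), abs_nonneg w]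
    nlinarith [abs_nonneg w]
  · linarith

lemma dsm_int (π : Measure ℝ) [IsProbabilityMeasure π] (a : ℝ) (v : NNReal) (hv0 : v ≠ 0) (x : ℝ) :
    Integrable (fun μ => gaussianPDFReal (a * μ) v x) π ∧
    Integrable (fun μ => gaussianPDFReal (a * μ) v x * ((x - a * μ) / v)) π ∧
    Integrable (fun μ => gaussianPDFReal (a * μ) v x * ((x - a * μ) / v) ^ 2) π := by
  obtain ⟨C, hC⟩ := dsm_bound v hv0
  have hm : Measurable (fun μ => gaussianPDFReal (a * μ) v x) := by
    unfold gaussianPDFReal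
    fun_prop
  refine ⟨Integrable.of_bound (C := C) hm.aestronglyMeasurable ?_, Integrable.of_bound (C := C) (by fun_prop) ?_,
    Integrable.of_bound (C := C) (by fun_prop) ?_⟩
  · exact .of_forall fun μ => (hC _ _).1
  · exact .of_forall fun μ => (hC _ _).2.1
  · exact .of_forall fun μ => (hC _ _).2.2

lemma dsm_pos (π : Measure ℝ) [IsProbabilityMeasure π] (a : ℝ) (v : NNReal) (hv0 : v ≠ 0) (x : ℝ) :
    0 < ∫ μ, gaussianPDFReal (a * μ) v x ∂π := by
  rw [integral_pos_iff_support_of_nonneg (fun μ => gaussianPDFReal_nonneg _ _ _)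
    (dsm_int π a v hv0 x).1]
  have : Function.support (fun μ => gaussianPDFReal (a * μ) v x) = Set.univ := by
    ext μ; simp [(gaussianPDFReal_pos (a * μ) v x hv0).ne']
  rw [this]; simp

lemma dsm_score (π : Measure ℝ) [IsProbabilityMeasure π] (a : ℝ) (v : NNReal) (hv0 : v ≠ 0) (x : ℝ) :
    deriv (fun y => Real.log (∫ μ, gaussianPDFReal (a * μ) v y ∂π)) x
      = - (∫ μ, gaussianPDFReal (a * μ) v x * ((x - a * μ) / v) ∂π) /
        ∫ μ, gaussianPDFReal (a * μ) v x ∂π := by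
  obtain ⟨C, hC⟩ := dsm_bound v hv0
  have hv : (v : ℝ) ≠ 0 := by positivity
  have hd := (hasDerivAt_integral_of_dominated_loc_of_deriv_le (μ := π) (x₀ := x) (s := Set.univ)
    (bound := fun _ => C)
    (F := fun y μ => gaussianPDFReal (a * μ) v y)
    (F' := fun y μ => - (gaussianPDFReal (a * μ) v y * ((y - a * μ) / v)))
    Filter.univ_mem (.of_forall fun y => (dsm_int π a v hv0 y).1.1) (dsm_int π a v hv0 x).1
    (dsm_int π a v hv0 x).2.1.1.neg
    (.of_forall fun μ y _ => by rw [norm_neg]; exact (hC _ _).2.1)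
    (integrable_const _)
    (.of_forall fun μ y _ => by
      unfold gaussianPDFReal
      have h1 : HasDerivAt (fun y => -(y - a * μ) ^ 2 / (2 * (v : ℝ))) (-((y - a * μ) / v)) y := by
        have := ((((hasDerivAt_id y).sub_const (a * μ)).pow 2).neg).div_const (2 * (v : ℝ))
        refine this.congr_deriv ?_
        simp only [id]
        field_simp
        norm_num
        ring
      refine ((h1.exp).const_mul ((√(2 * Real.pi * v))⁻¹)).congr_deriv ?_
      ring)).2
  rw [(hd.log (dsm_pos π a v hv0 x).ne').deriv, integral_neg]

lemma dsm_cs (π : Measure ℝ) [IsProbabilityMeasure π] (a : ℝ) (v : NNReal) (hv0 : v ≠ 0) (x s : ℝ)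
    (hs : s = - (∫ μ, gaussianPDFReal (a * μ) v x * ((x - a * μ) / v) ∂π) /
        ∫ μ, gaussianPDFReal (a * μ) v x ∂π) :
    s ^ 2 * (∫ μ, gaussianPDFReal (a * μ) v x ∂π) ≤
      ∫ μ, gaussianPDFReal (a * μ) v x * ((x - a * μ) / v) ^ 2 ∂π := by
  obtain ⟨h0, h1, h2⟩ := dsm_int π a v hv0 x
  have hP := dsm_pos π a v hv0 x
  have h : 0 ≤ ∫ μ, (gaussianPDFReal (a * μ) v x * ((x - a * μ) / v) ^ 2
      + 2 * s * (gaussianPDFReal (a * μ) v x * ((x - a * μ) / v)) 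
      + s ^ 2 * gaussianPDFReal (a * μ) v x) ∂π := by
    refine integral_nonneg fun μ => ?_
    have : 0 ≤ gaussianPDFReal (a * μ) v x * ((x - a * μ) / v + s) ^ 2 :=
      mul_nonneg (gaussianPDFReal_nonneg _ _ _) (sq_nonneg _)
    simp only [Pi.zero_apply]; linarith
  rw [dsm_add3 _ _ _ _ h2 (h1.const_mul _) (h0.const_mul _),
    integral_const_mul, integral_const_mul] at h
  rw [eq_div_iff hP.ne'] at hs
  have hs2 := congrArg (fun t => s * t) hs
  nlinarith

lemma dsm_ortho (π : Measure ℝ) [IsProbabilityMeasure π] (a σ : ℝ) (hσ : 0 < σ) (v : NNReal)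
    (hv : (v : ℝ) = σ ^ 2) (hv0 : v ≠ 0) (s : ℝ → ℝ) (hsm : Measurable s)
    (hs : ∀ x, s x = - (∫ μ, gaussianPDFReal (a * μ) v x * ((x - a * μ) / v) ∂π) /
        ∫ μ, gaussianPDFReal (a * μ) v x ∂π) (h : ℝ → ℝ) (hm : Measurable h)
    (hi : Integrable (fun q : ℝ × ℝ => h (a * q.1 + σ * q.2) * (s (a * q.1 + σ * q.2) + q.2 / σ))
      (π.prod (gaussianReal 0 1))) :
    ∫ q : ℝ × ℝ, h (a * q.1 + σ * q.2) * (s (a * q.1 + σ * q.2) + q.2 / σ)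
      ∂(π.prod (gaussianReal 0 1)) = 0 := by
  have e : (fun q : ℝ × ℝ => h (a * q.1 + σ * q.2) * (s (a * q.1 + σ * q.2) + q.2 / σ))
    = fun q : ℝ × ℝ => (fun r : ℝ × ℝ => h r.2 * (s r.2 + (r.2 - a * r.1) / v))
      (q.1, a * q.1 + σ * q.2) := by
    funext q
    simp only [hv]
    congr 2
    field_simp; ring
  rw [e] at hi ⊢
  have hfm : Measurable (fun r : ℝ × ℝ => h r.2 * (s r.2 + (r.2 - a * r.1) / v)) := by fun_prop
  rw [dsm_integrable π a σ v hv hv0 _ hfm] at hi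
  rw [dsm_integral π a σ v hv hv0 _ hfm, integral_prod_symm _ hi]
  refine integral_eq_zero_of_ae (.of_forall fun x => ?_)
  obtain ⟨h0, h1, h2⟩ := dsm_int π a v hv0 x
  have hP := dsm_pos π a v hv0 x
  have e2 : ∀ μ, gaussianPDFReal (a * μ) v x * (h x * (s x + (x - a * μ) / v)) =
      h x * s x * gaussianPDFReal (a * μ) v x
      + h x * (gaussianPDFReal (a * μ) v x * ((x - a * μ) / v)) := fun μ => by ring
  simp only [e2]
  rw [integral_add (h0.const_mul _) (h1.const_mul _), integral_const_mul, integral_const_mul]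
  have := hs x
  rw [eq_div_iff hP.ne'] at this
  simp only [Pi.zero_apply]
  rw [mul_assoc, this]; ring

lemma dsm_sq (π : Measure ℝ) [IsProbabilityMeasure π] (a σ : ℝ) (hσ : 0 < σ) (v : NNReal)
    (hv : (v : ℝ) = σ ^ 2) (hv0 : v ≠ 0) (s : ℝ → ℝ) (hsm : Measurable s)
    (hs : ∀ x, s x = - (∫ μ, gaussianPDFReal (a * μ) v x * ((x - a * μ) / v) ∂π) /
        ∫ μ, gaussianPDFReal (a * μ) v x ∂π)
    (hz : Integrable (fun q : ℝ × ℝ => (q.2 / σ) ^ 2) (π.prod (gaussianReal 0 1))) :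
    Integrable (fun q : ℝ × ℝ => (s (a * q.1 + σ * q.2)) ^ 2) (π.prod (gaussianReal 0 1)) := by
  have hK := dsm_meas a v
  have e : (fun q : ℝ × ℝ => (q.2 / σ) ^ 2)
    = fun q : ℝ × ℝ => (fun r : ℝ × ℝ => ((r.2 - a * r.1) / v) ^ 2)
      (q.1, a * q.1 + σ * q.2) := by
    funext q
    simp only [hv]
    congr 1
    field_simp; ring
  have hfm : Measurable (fun r : ℝ × ℝ => ((r.2 - a * r.1) / v) ^ 2) := by fun_prop
  rw [e, dsm_integrable π a σ v hv hv0 _ hfm] at hz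
  have hz' := hz.integral_prod_right
  rw [dsm_integrable π a σ v hv hv0 (fun r => s r.2 ^ 2) (by fun_prop),
    integrable_prod_iff' (by fun_prop)]
  refine ⟨.of_forall fun x => (dsm_int π a v hv0 x).1.mul_const (s x ^ 2), ?_⟩
  have e3 : ∀ x, ∫ μ, ‖gaussianPDFReal (a * μ) v x * s x ^ 2‖ ∂π
      = s x ^ 2 * ∫ μ, gaussianPDFReal (a * μ) v x ∂π := by
    intro x
    rw [← integral_const_mul]
    refine integral_congr_ae (.of_forall fun μ => ?_)
    simp only
    rw [Real.norm_of_nonneg (mul_nonneg (gaussianPDFReal_nonneg _ _ _) (sq_nonneg _)), mul_comm]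
  simp only [e3]
  refine hz'.mono' ?_ (.of_forall fun x => ?_)
  · refine ((hsm.pow_const 2).aestronglyMeasurable).mul ?_
    exact (hK.stronglyMeasurable.integral_prod_left' (μ := π)).aestronglyMeasurable
  · rw [Real.norm_of_nonneg (mul_nonneg (sq_nonneg _) (dsm_pos π a v hv0 x).le)]
    exact dsm_cs π a v hv0 x (s x) (hs x)

/-- Denoising score matching has the score as its unique minimiser: with
`p` the density of the law of `a·X₀ + σ·Z` (`X₀ ~ π`, `Z ~ N(0,1)` independent) and
`s = (log p)'` its score, the objective `∫ (u(aμ+σz) + z/σ)² d(π⊗γ)` is finite at `u = s`,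
is minimised by `u = s` among all measurable square-integrable `u`, with equality iff
`u = s` almost everywhere with respect to the law of `aμ + σz`. -/
theorem stmt2 (π : Measure ℝ) [IsProbabilityMeasure π] (a σ : ℝ) (ha : a ≠ 0) (hσ : 0 < σ)
    (p : ℝ → ℝ)
    (hp : ∀ x, p x = (2 * Real.pi * σ ^ 2) ^ (-(1 : ℝ) / 2) *
      ∫ μ, Real.exp (-(x - a * μ) ^ 2 / (2 * σ ^ 2)) ∂π)
    (s : ℝ → ℝ) (hs : ∀ x, s x = deriv (fun y => Real.log (p y)) x) :
    Integrable (fun q : ℝ × ℝ => (s (a * q.1 + σ * q.2) + q.2 / σ) ^ 2)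
      (π.prod (gaussianReal 0 1)) ∧
    ∀ u : ℝ → ℝ, Measurable u →
      Integrable (fun q : ℝ × ℝ => (u (a * q.1 + σ * q.2)) ^ 2) (π.prod (gaussianReal 0 1)) →
      ((∫ q : ℝ × ℝ, (s (a * q.1 + σ * q.2) + q.2 / σ) ^ 2 ∂(π.prod (gaussianReal 0 1)))
          ≤ ∫ q : ℝ × ℝ, (u (a * q.1 + σ * q.2) + q.2 / σ) ^ 2 ∂(π.prod (gaussianReal 0 1))) ∧
      ((∫ q : ℝ × ℝ, (u (a * q.1 + σ * q.2) + q.2 / σ) ^ 2 ∂(π.prod (gaussianReal 0 1))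
          = ∫ q : ℝ × ℝ, (s (a * q.1 + σ * q.2) + q.2 / σ) ^ 2 ∂(π.prod (gaussianReal 0 1)))
        ↔ u =ᵐ[Measure.map (fun q : ℝ × ℝ => a * q.1 + σ * q.2) (π.prod (gaussianReal 0 1))] s) := by
  have hσ0 := hσ.ne'
  set v : NNReal := ⟨σ ^ 2, sq_nonneg σ⟩ with hvdef
  have hv : (v : ℝ) = σ ^ 2 := rfl
  have hv0 : v ≠ 0 := by
    intro h
    have : (v : ℝ) = 0 := by rw [h]; rfl
    rw [hv] at this; exact (pow_pos hσ 2).ne' this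
  have hpK : p = fun x => ∫ μ, gaussianPDFReal (a * μ) v x ∂π := by
    funext x
    rw [hp x]
    simp only [gaussianPDFReal, integral_const_mul, hv]
    congr 1
    rw [Real.sqrt_eq_rpow, ← Real.rpow_neg (by positivity)]
    norm_num
  have hs' : ∀ x, s x = - (∫ μ, gaussianPDFReal (a * μ) v x * ((x - a * μ) / v) ∂π) /
        ∫ μ, gaussianPDFReal (a * μ) v x ∂π := by
    intro x
    rw [hs x, hpK]
    exact dsm_score π a v hv0 x
  have hsm : Measurable s := by
    rw [show s = deriv (fun y => Real.log (p y)) from funext hs]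
    exact measurable_deriv _
  set ν := π.prod (gaussianReal 0 1) with hν
  have hZ : MemLp (fun q : ℝ × ℝ => q.2 / σ) 2 ν := by
    have h1 : MemLp (id : ℝ → ℝ) 2 (gaussianReal 0 1) := by
      exact_mod_cast memLp_id_gaussianReal (μ := 0) (v := 1) 2
    have h2 : MemLp (fun q : ℝ × ℝ => q.2) 2 ν :=
      h1.comp_measurePreserving (measurePreserving_snd (μ := π) (ν := gaussianReal 0 1))
    simpa [div_eq_inv_mul] using h2.const_mul σ⁻¹
  have hS : MemLp (fun q : ℝ × ℝ => s (a * q.1 + σ * q.2)) 2 ν :=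
    (memLp_two_iff_integrable_sq (hsm.comp (by fun_prop)).aestronglyMeasurable).2
      (dsm_sq π a σ hσ v hv hv0 s hsm hs' hZ.integrable_sq)
  have hSZ := hS.add hZ
  have hSZ2 : Integrable (fun q : ℝ × ℝ => (s (a * q.1 + σ * q.2) + q.2 / σ) ^ 2) ν :=
    hSZ.integrable_sq
  refine ⟨hSZ2, fun u hu hu2 => ?_⟩
  have hU : MemLp (fun q : ℝ × ℝ => u (a * q.1 + σ * q.2)) 2 ν :=
    (memLp_two_iff_integrable_sq (hu.comp (by fun_prop)).aestronglyMeasurable).2 hu2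
  have hD := hU.sub hS
  have hD2 : Integrable (fun q : ℝ × ℝ =>
      (u (a * q.1 + σ * q.2) - s (a * q.1 + σ * q.2)) ^ 2) ν := hD.integrable_sq
  have hX : Integrable (fun q : ℝ × ℝ => (u (a * q.1 + σ * q.2) - s (a * q.1 + σ * q.2)) *
      (s (a * q.1 + σ * q.2) + q.2 / σ)) ν := hD.integrable_mul hSZ
  have hX0 := dsm_ortho π a σ hσ v hv hv0 s hsm hs' (fun x => u x - s x) (hu.sub hsm) hX
  have key : ∫ q : ℝ × ℝ, (u (a * q.1 + σ * q.2) + q.2 / σ) ^ 2 ∂ν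
      = (∫ q : ℝ × ℝ, (s (a * q.1 + σ * q.2) + q.2 / σ) ^ 2 ∂ν)
        + ∫ q : ℝ × ℝ, (u (a * q.1 + σ * q.2) - s (a * q.1 + σ * q.2)) ^ 2 ∂ν := by
    have e : ∀ q : ℝ × ℝ, (u (a * q.1 + σ * q.2) + q.2 / σ) ^ 2
        = (s (a * q.1 + σ * q.2) + q.2 / σ) ^ 2
          + (u (a * q.1 + σ * q.2) - s (a * q.1 + σ * q.2)) ^ 2
          + 2 * ((u (a * q.1 + σ * q.2) - s (a * q.1 + σ * q.2)) *
            (s (a * q.1 + σ * q.2) + q.2 / σ)) := fun q => by ring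
    simp only [e]
    rw [dsm_add3 _ _ _ _ hSZ2 hD2 (hX.const_mul 2),
      integral_const_mul, hX0]
    ring
  rw [key]
  refine ⟨le_add_of_nonneg_right (integral_nonneg fun q => sq_nonneg _), ?_⟩
  rw [add_eq_left, integral_eq_zero_iff_of_nonneg (fun q => sq_nonneg _) hD2]
  have : (u =ᵐ[Measure.map (fun q : ℝ × ℝ => a * q.1 + σ * q.2) ν] s) ↔
      ∀ᵐ q ∂ν, u (a * q.1 + σ * q.2) = s (a * q.1 + σ * q.2) :=
    ae_map_iff (by fun_prop) (measurableSet_eq_fun hu hsm)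
  rw [this]
  refine Filter.eventually_congr (.of_forall fun q => ?_)
  simp [sub_eq_zero]
end

section
/- Variance-optimal weight function (optimality part of Lemma 3.1): Let φ = (1+√5)/2. Let α : [0,1] → ℝ be continuous on [0,1], differentiable on (0,1), with α(0) = 0 and α(1) = 1, and suppose the function s ↦ α'(s)² + (1−α(s))²/(1−s)² is Lebesgue integrable on (0,1). Then ∫₀¹ α'(s)² ds + ∫₀¹ (1−α(s))²/(1−s)² ds ≥ φ, and equality holds if and only if α(s) = 1 − (1−s)^φ for all s ∈ [0,1] (equivalently α'(s) = φ(1−s)^{φ−1} on (0,1)). In particular, α(s) = 1 − (1−s)^φ is the unique minimiser of the variance expression (1/(α(1)−α(0)))( ∫₀¹ α'(s)² ds + ∫₀¹ (α(1)−α(s))²/(1−s)² ds + d² ) of the Bismut–Elworthy–Li estimator for the Brownian bridge, among admissible α normalised by α(0)=0, α(1)=1. -/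
open MeasureTheory

lemma aux_tail (α : ℝ → ℝ)
    (hc : ContinuousOn α (Set.Icc 0 1))
    (hd : ∀ s ∈ Set.Ioo (0 : ℝ) 1, DifferentiableAt ℝ α s)
    (h1 : α 1 = 1)
    (hg2 : IntervalIntegrable (fun s => (deriv α s) ^ 2) volume 0 1)
    (s : ℝ) (hs : s ∈ Set.Ico (0:ℝ) 1) :
    (1 - α s) ^ 2 / (1 - s) ≤ ∫ x in s..1, (deriv α x) ^ 2 := by
  have ht : 0 < 1 - s := by linarith [hs.2]
  have hg2' : IntervalIntegrable (fun s => (deriv α s) ^ 2) volume s 1 :=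
    hg2.mono_set (by
      rw [Set.uIcc_of_le hs.2.le, Set.uIcc_of_le zero_le_one]
      exact Set.Icc_subset_Icc_left hs.1)
  have hg1 : IntervalIntegrable (deriv α) volume s 1 := by
    have : IntervalIntegrable (fun s => 1 + (deriv α s) ^ 2) volume s 1 :=
      intervalIntegrable_const.add hg2'
    refine this.mono_fun (measurable_deriv α).aestronglyMeasurable ?_
    refine Filter.Eventually.of_forall fun x => ?_
    simp only [Real.norm_eq_abs]
    rw [abs_of_nonneg (by positivity : (0:ℝ) ≤ 1 + (deriv α x) ^ 2)]
    rw [abs_le]; constructor <;> nlinarith [sq_nonneg (deriv α x - 1), sq_nonneg (deriv α x + 1)]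
  have ftc : ∫ x in s..1, deriv α x = 1 - α s := by
    conv_rhs => rw [← h1]
    refine intervalIntegral.integral_eq_sub_of_hasDerivAt_of_le hs.2.le
      (hc.mono (Set.Icc_subset_Icc_left hs.1)) (fun x hx => ?_) hg1
    exact (hd x ⟨lt_of_le_of_lt hs.1 hx.1, hx.2⟩).hasDerivAt
  set m := (1 - α s) / (1 - s) with hm
  have hnn : 0 ≤ ∫ x in s..1, (((deriv α x) ^ 2 - (2 * m) * deriv α x) + m ^ 2) := by
    refine intervalIntegral.integral_nonneg hs.2.le fun x _ => ?_
    nlinarith [sq_nonneg (deriv α x - m)]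
  rw [intervalIntegral.integral_add (hg2'.sub (hg1.const_mul _)) intervalIntegrable_const,
    intervalIntegral.integral_sub hg2' (hg1.const_mul _), intervalIntegral.integral_const_mul,
    ftc, intervalIntegral.integral_const, smul_eq_mul] at hnn
  have e : (1 - α s) ^ 2 / (1 - s) = 2 * m * (1 - α s) - (1 - s) * m ^ 2 := by
    rw [hm]; field_simp; ring
  linarith

lemma aux_main (φ : ℝ) (hφ2 : φ ^ 2 = φ + 1) (hφ0 : 0 < φ) (α : ℝ → ℝ)
    (hc : ContinuousOn α (Set.Icc 0 1))
    (hd : ∀ s ∈ Set.Ioo (0 : ℝ) 1, DifferentiableAt ℝ α s)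
    (h0 : α 0 = 0) (h1 : α 1 = 1)
    (hint : IntegrableOn (fun s => (deriv α s) ^ 2 + (1 - α s) ^ 2 / (1 - s) ^ 2)
      (Set.Ioo 0 1) volume) :
    IntegrableOn (fun s => (deriv α s - φ * ((1 - α s) / (1 - s))) ^ 2) (Set.Ioo 0 1) volume ∧
    (∫ s in Set.Ioo (0 : ℝ) 1, (deriv α s) ^ 2) +
        (∫ s in Set.Ioo (0 : ℝ) 1, (1 - α s) ^ 2 / (1 - s) ^ 2) = φ +
      ∫ s in Set.Ioo (0 : ℝ) 1, (deriv α s - φ * ((1 - α s) / (1 - s))) ^ 2 := by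
  have hA : IntegrableOn (fun s => (deriv α s) ^ 2) (Set.Ioo 0 1) volume := by
    refine Integrable.mono' hint ((measurable_deriv α).pow_const 2).aestronglyMeasurable ?_
    refine Filter.Eventually.of_forall fun x => ?_
    rw [Real.norm_eq_abs, abs_of_nonneg (by positivity)]
    have : 0 ≤ (1 - α x) ^ 2 / (1 - x) ^ 2 := by positivity
    linarith
  have hB : IntegrableOn (fun s => (1 - α s) ^ 2 / (1 - s) ^ 2) (Set.Ioo 0 1) volume := by
    refine (hint.sub hA).congr (Filter.Eventually.of_forall fun x => ?_)
    simp
  have hwm : AEStronglyMeasurable (fun s => (1 - α s) / (1 - s))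
      (volume.restrict (Set.Ioo 0 1)) := by
    refine ContinuousOn.aestronglyMeasurable ?_ measurableSet_Ioo
    refine ContinuousOn.div (continuousOn_const.sub (hc.mono Set.Ioo_subset_Icc_self))
      (by fun_prop) fun x hx => ?_
    linarith [hx.2]
  have hC : IntegrableOn (fun s => deriv α s * ((1 - α s) / (1 - s))) (Set.Ioo 0 1) volume := by
    refine Integrable.mono' hint ((measurable_deriv α).aestronglyMeasurable.mul hwm) ?_
    refine Filter.Eventually.of_forall fun x => ?_
    rw [Real.norm_eq_abs, ← div_pow, abs_le]
    generalize (1 - α x) / (1 - x) = w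
    generalize deriv α x = g
    constructor <;> nlinarith [sq_nonneg (g - w), sq_nonneg (g + w), sq_nonneg g, sq_nonneg w]
  have hGi : IntegrableOn (fun s => φ * ((1 - α s) ^ 2 / (1 - s) ^ 2)
      - (2 * φ) * (deriv α s * ((1 - α s) / (1 - s)))) (Set.Ioo 0 1) volume :=
    (hB.const_mul φ).sub (hC.const_mul _)
  have hQe : ∀ s, (deriv α s - φ * ((1 - α s) / (1 - s))) ^ 2 =
      ((deriv α s) ^ 2 + (1 - α s) ^ 2 / (1 - s) ^ 2) + (φ * ((1 - α s) ^ 2 / (1 - s) ^ 2)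
      - (2 * φ) * (deriv α s * ((1 - α s) / (1 - s)))) := by
    intro s
    rw [← div_pow]
    linear_combination ((1 - α s) / (1 - s)) ^ 2 * hφ2
  have hFTC : ∫ s in Set.Ioo (0:ℝ) 1, (φ * ((1 - α s) ^ 2 / (1 - s) ^ 2)
      - (2 * φ) * (deriv α s * ((1 - α s) / (1 - s)))) = - φ := by
    rw [← integral_Ioc_eq_integral_Ioo, ← intervalIntegral.integral_of_le zero_le_one]
    have key := intervalIntegral.integral_eq_sub_of_hasDerivAt_of_le
      (f := fun s => φ * ((1 - α s) ^ 2 / (1 - s)))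
      (f' := fun s => φ * ((1 - α s) ^ 2 / (1 - s) ^ 2)
      - (2 * φ) * (deriv α s * ((1 - α s) / (1 - s)))) (zero_le_one (α := ℝ)) ?_ ?_ ?_
    · rw [key]; simp [h0, h1]
    · have hA' : IntervalIntegrable (fun s => (deriv α s) ^ 2) volume 0 1 := by
        rw [intervalIntegrable_iff_integrableOn_Ioo_of_le zero_le_one]; exact hA
      intro s hs
      rcases hs.2.lt_or_eq with h | h
      · refine ContinuousWithinAt.mul continuousWithinAt_const ?_
        refine ContinuousWithinAt.div ((continuousWithinAt_const.sub (hc s hs)).pow 2)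
          (by fun_prop) (by linarith)
      · subst h
        have hT : Filter.Tendsto (fun s => φ * ∫ x in s..1, (deriv α x) ^ 2)
            (nhdsWithin 1 (Set.Icc 0 1)) (nhds 0) := by
          have hcont : ContinuousOn (fun s => ∫ x in (1:ℝ)..s, (deriv α x) ^ 2)
              (Set.uIcc 0 1) := by
            refine intervalIntegral.continuousOn_primitive_interval' hA' ?_
            simp
          have := hcont 1 (by simp)
          rw [Set.uIcc_of_le zero_le_one] at this
          have h2 := (this.tendsto.neg).const_mul φ
          simp only [intervalIntegral.integral_same, neg_zero, mul_zero] at h2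
          refine h2.congr fun s => ?_
          rw [intervalIntegral.integral_symm, neg_neg]
        unfold ContinuousWithinAt
        simp only [sub_self, div_zero, mul_zero]
        refine tendsto_of_tendsto_of_tendsto_of_le_of_le' tendsto_const_nhds hT ?_ ?_
        · filter_upwards [self_mem_nhdsWithin] with x hx
          have : 0 ≤ 1 - x := by linarith [hx.2]
          positivity
        · filter_upwards [self_mem_nhdsWithin] with x hx
          rcases hx.2.lt_or_eq with h | h
          · exact mul_le_mul_of_nonneg_left (aux_tail α hc hd h1 hA' x ⟨hx.1, h⟩) hφ0.le
          · subst h; simp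
    · intro s hs
      have ht : 1 - s ≠ 0 := by linarith [hs.2]
      have := ((((hd s hs).hasDerivAt.const_sub 1).pow 2).div
        ((hasDerivAt_id s).const_sub 1) ht).const_mul φ
      refine HasDerivAt.congr_deriv this ?_
      simp only [id, Pi.pow_apply, Nat.cast_ofNat]
      field_simp
      push_cast
      ring
    · rw [intervalIntegrable_iff_integrableOn_Ioo_of_le zero_le_one]; exact hGi
  simp_rw [hQe]
  refine ⟨hint.add hGi, ?_⟩
  rw [integral_add hint hGi, hFTC, integral_add hA hB]
  ring

theorem stmt4 (φ : ℝ) (hφ : φ = (1 + Real.sqrt 5) / 2) (α : ℝ → ℝ)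
    (hc : ContinuousOn α (Set.Icc 0 1))
    (hd : ∀ s ∈ Set.Ioo (0 : ℝ) 1, DifferentiableAt ℝ α s)
    (h0 : α 0 = 0) (h1 : α 1 = 1)
    (hint : IntegrableOn (fun s => (deriv α s) ^ 2 + (1 - α s) ^ 2 / (1 - s) ^ 2)
      (Set.Ioo 0 1) volume) :
    (φ ≤ (∫ s in Set.Ioo (0 : ℝ) 1, (deriv α s) ^ 2) +
        ∫ s in Set.Ioo (0 : ℝ) 1, (1 - α s) ^ 2 / (1 - s) ^ 2) ∧
    (((∫ s in Set.Ioo (0 : ℝ) 1, (deriv α s) ^ 2) +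
        (∫ s in Set.Ioo (0 : ℝ) 1, (1 - α s) ^ 2 / (1 - s) ^ 2) = φ)
      ↔ ∀ s ∈ Set.Icc (0 : ℝ) 1, α s = 1 - (1 - s) ^ φ) := by
  have h5 : Real.sqrt 5 ^ 2 = 5 := Real.sq_sqrt (by norm_num)
  have hφ2 : φ ^ 2 = φ + 1 := by rw [hφ]; linear_combination h5 / 4
  have hφ0 : 0 < φ := by rw [hφ]; positivity
  obtain ⟨hQi, hE⟩ := aux_main φ hφ2 hφ0 α hc hd h0 h1 hint
  rw [hE]
  have hQ0 : 0 ≤ ∫ s in Set.Ioo (0 : ℝ) 1, (deriv α s - φ * ((1 - α s) / (1 - s))) ^ 2 :=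
    integral_nonneg fun s => sq_nonneg _
  refine ⟨by linarith, ?_, ?_⟩
  · intro h
    have hz : ∫ s in Set.Ioo (0 : ℝ) 1, (deriv α s - φ * ((1 - α s) / (1 - s))) ^ 2 = 0 := by
      linarith
    rw [integral_eq_zero_iff_of_nonneg (fun s => sq_nonneg _) hQi] at hz
    intro s hs
    rcases hs.2.lt_or_eq with hs1 | hs1
    swap
    · subst hs1; simp [h1, Real.zero_rpow hφ0.ne']
    have hz' : ∀ᵐ x ∂volume.restrict (Set.Ioc 0 s), deriv α x * (1 - x) ^ (-φ)
        - φ * (1 - x) ^ (-φ - 1) * (1 - α x) = 0 := by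
      have hsub : Set.Ioc 0 s ⊆ Set.Ioo 0 1 := fun x hx => ⟨hx.1, lt_of_le_of_lt hx.2 hs1⟩
      filter_upwards [ae_restrict_of_ae_restrict_of_subset hsub hz,
        ae_restrict_mem measurableSet_Ioc] with x hx hxm
      have ht : 0 < 1 - x := by linarith [hxm.2]
      have hx' : deriv α x = φ * ((1 - α x) / (1 - x)) := by
        have := pow_eq_zero_iff (two_ne_zero) |>.mp hx
        linarith
      rw [hx', Real.rpow_sub_one ht.ne']
      field_simp
      ring
    have hzI : (fun x => deriv α x * (1 - x) ^ (-φ)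
        - φ * (1 - x) ^ (-φ - 1) * (1 - α x)) =ᵐ[volume.restrict (Set.Ioc 0 s)] fun _ => 0 := hz'
    have key := intervalIntegral.integral_eq_sub_of_hasDerivAt_of_le
      (f := fun x => -((1 - α x) * (1 - x) ^ (-φ)))
      (f' := fun x => deriv α x * (1 - x) ^ (-φ)
        - φ * (1 - x) ^ (-φ - 1) * (1 - α x)) hs.1 ?_ ?_ ?_
    · rw [intervalIntegral.integral_of_le hs.1, integral_congr_ae hzI] at key
      simp only [integral_zero, h0, sub_zero, Real.one_rpow, mul_one] at key
      have ht : 0 < 1 - s := by linarith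
      rw [Real.rpow_neg ht.le] at key
      have hp : 0 < (1 - s) ^ φ := Real.rpow_pos_of_pos ht _
      field_simp at key
      linarith
    · refine ContinuousOn.neg (ContinuousOn.mul (continuousOn_const.sub
        (hc.mono (Set.Icc_subset_Icc_right hs.2))) ?_)
      refine ContinuousOn.rpow_const (by fun_prop) fun x hx => Or.inl ?_
      linarith [hx.2]
    · intro x hx
      have ht : 1 - x ≠ 0 := by linarith [hx.2]
      have hx1 : x ∈ Set.Ioo (0:ℝ) 1 := ⟨hx.1, hx.2.trans hs1⟩
      have := (((hd x hx1).hasDerivAt.const_sub 1).mul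
        (((hasDerivAt_id x).const_sub 1).rpow_const (p := -φ) (Or.inl ht))).neg
      refine HasDerivAt.congr_deriv this ?_
      simp only [id]
      ring
    · rw [intervalIntegrable_iff_integrableOn_Ioc_of_le hs.1]
      exact (integrable_zero _ _ _).congr hzI.symm
  · intro h
    have : ∫ s in Set.Ioo (0 : ℝ) 1, (deriv α s - φ * ((1 - α s) / (1 - s))) ^ 2 = 0 := by
      rw [setIntegral_congr_fun (g := fun _ => (0:ℝ)) measurableSet_Ioo]
      · simp
      intro s hs
      have ht : 0 < 1 - s := by linarith [hs.2]
      have hder : HasDerivAt (fun x : ℝ => 1 - (1 - x) ^ φ) (φ * (1 - s) ^ (φ - 1)) s := by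
        have := (((hasDerivAt_id s).const_sub 1).rpow_const (p := φ) (Or.inl ht.ne')).const_sub 1
        refine HasDerivAt.congr_deriv this ?_
        simp only [id]
        ring
      have he : α =ᶠ[nhds s] fun x : ℝ => 1 - (1 - x) ^ φ := by
        filter_upwards [Ioo_mem_nhds hs.1 hs.2] with x hx
        exact h x ⟨hx.1.le, hx.2.le⟩
      have hda := he.deriv_eq.trans hder.deriv
      simp only
      rw [hda, h s ⟨hs.1.le, hs.2.le⟩, Real.rpow_sub_one ht.ne']
      ring
    rw [this, add_zero]
end

section
/- Brownian-bridge covariance double-integral identity: Let α : [0,1] → ℝ be continuous on [0,1] and continuously differentiable on [0,1), and write A(s) := α(1) − α(s). Assume (i) A(s)²/(1−s) → 0 as s → 1⁻, (ii) ∫₀¹ A(s)²/(1−s)² ds < ∞, and (iii) the function (s,t) ↦ α'(s) α'(t) (min(s,t) − st)/((1−s)(1−t)) is absolutely integrable on the square (0,1)². Then ∫₀¹ ∫₀¹ α'(s) α'(t) (min(s,t) − st)/((1−s)(1−t)) ds dt = ∫₀¹ (α(1)−α(s))²/(1−s)² ds. -/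
open MeasureTheory

lemma aux_w (m : ℝ) (h0 : 0 ≤ m) (h1 : m < 1) :
    ∫ u in Set.Ioo (0:ℝ) m, 1 / (1 - u) ^ 2 = 1 / (1 - m) - 1 := by
  rw [← integral_Ioc_eq_integral_Ioo, ← intervalIntegral.integral_of_le h0]
  have hne : ∀ x ∈ Set.uIcc 0 m, (1 - x) ≠ 0 := by
    intro x hx
    rw [Set.uIcc_of_le h0] at hx
    have := hx.2
    intro h
    linarith
  have := intervalIntegral.integral_eq_sub_of_hasDerivAt (a := 0) (b := m)
    (f := fun u : ℝ => 1 / (1 - u)) (f' := fun u => 1 / (1 - u) ^ 2) ?_ ?_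
  · rw [this]; norm_num
  · intro x hx
    have h := ((hasDerivAt_id x).const_sub 1).inv (hne x hx)
    simp only [one_div]
    have e : ((1 - x) ^ 2)⁻¹ = - -1 / (1 - id x) ^ 2 := by simp
    rw [e]
    exact h
  · apply ContinuousOn.intervalIntegrable
    apply ContinuousOn.div (by fun_prop) (by fun_prop)
    intro x hx
    exact pow_ne_zero _ (hne x hx)

lemma aux_wint (T : ℝ) (h1 : T < 1) :
    IntegrableOn (fun u : ℝ => 1 / (1 - u) ^ 2) (Set.Ioo 0 T) volume := by
  have : IntegrableOn (fun u : ℝ => 1 / (1 - u) ^ 2) (Set.Icc 0 T) volume := by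
    apply ContinuousOn.integrableOn_Icc
    apply ContinuousOn.div (by fun_prop) (by fun_prop)
    intro x hx
    have := hx.2
    apply pow_ne_zero
    intro h
    linarith
  exact this.mono_set Set.Ioo_subset_Icc_self

lemma aux_T (α : ℝ → ℝ)
    (hd : ∀ s ∈ Set.Ico (0 : ℝ) 1, DifferentiableAt ℝ α s)
    (hd' : ContinuousOn (deriv α) (Set.Ico 0 1)) (T : ℝ) (h0 : 0 < T) (h1 : T < 1) :
    ∫ q in Set.Ioo (0 : ℝ) T ×ˢ Set.Ioo (0 : ℝ) T,
        deriv α q.1 * deriv α q.2 * (min q.1 q.2 - q.1 * q.2) / ((1 - q.1) * (1 - q.2))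
      = ∫ u in Set.Ioo (0 : ℝ) T, (α T - α u) ^ 2 / (1 - u) ^ 2 := by
  have hsub : Set.Icc 0 T ⊆ Set.Ico (0:ℝ) 1 := fun x hx => ⟨hx.1, hx.2.trans_lt h1⟩
  have hf : IntegrableOn (deriv α) (Set.Ioo 0 T) volume :=
    ((hd'.mono hsub).integrableOn_Icc).mono_set Set.Ioo_subset_Icc_self
  have hw := aux_wint T h1
  set μ : Measure ℝ := volume.restrict (Set.Ioo 0 T) with hμ
  set S : Set ((ℝ × ℝ) × ℝ) := {p | p.2 < p.1.1 ∧ p.2 < p.1.2} with hS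
  have hSm : MeasurableSet S :=
    MeasurableSet.inter (s₁ := {p : (ℝ × ℝ) × ℝ | p.2 < p.1.1})
      (s₂ := {p : (ℝ × ℝ) × ℝ | p.2 < p.1.2})
      (measurableSet_lt measurable_snd (measurable_fst.comp measurable_fst))
      (measurableSet_lt measurable_snd (measurable_snd.comp measurable_fst))
  set H : ℝ × ℝ → ℝ → ℝ := fun q u =>
    S.indicator (fun p => deriv α p.1.1 * deriv α p.1.2 * (1 / (1 - p.2) ^ 2)) (q, u) with hH
  have hHint : Integrable (Function.uncurry H) ((μ.prod μ).prod μ) := by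
    have h2 := (Integrable.mul_prod hf hf).mul_prod hw
    exact h2.indicator hSm
  have hswap := integral_integral_swap hHint
  have hL : ∫ q, ∫ u, H q u ∂μ ∂(μ.prod μ) =
      ∫ q in Set.Ioo (0 : ℝ) T ×ˢ Set.Ioo (0 : ℝ) T,
        deriv α q.1 * deriv α q.2 * (min q.1 q.2 - q.1 * q.2) / ((1 - q.1) * (1 - q.2)) := by
    rw [hμ, Measure.prod_restrict, ← Measure.volume_eq_prod, ← hμ]
    apply setIntegral_congr_fun (measurableSet_Ioo.prod measurableSet_Ioo)
    rintro ⟨s, t⟩ ⟨⟨hs0, hsT⟩, ⟨ht0, htT⟩⟩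
    simp only at hs0 hsT ht0 htT ⊢
    have e1 : ∀ u, H (s, t) u = (Set.Iio (min s t)).indicator
        (fun u => deriv α s * deriv α t * (1 / (1 - u) ^ 2)) u := by
      intro u
      simp only [hH, hS, Set.indicator, Set.mem_ofPred_eq, Set.mem_Iio, lt_min_iff]
    simp_rw [e1]
    rw [integral_indicator measurableSet_Iio, hμ, Measure.restrict_restrict measurableSet_Iio]
    have e2 : Set.Iio (min s t) ∩ Set.Ioo 0 T = Set.Ioo 0 (min s t) := by
      ext x
      simp only [Set.mem_inter_iff, Set.mem_Iio, Set.mem_Ioo, lt_min_iff]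
      constructor
      · rintro ⟨⟨a, b⟩, c, d⟩; exact ⟨c, a, b⟩
      · rintro ⟨c, a, b⟩; exact ⟨⟨a, b⟩, c, a.trans hsT⟩
    rw [e2, integral_const_mul, aux_w _ (le_min hs0.le ht0.le) ((min_le_left _ _).trans_lt (hsT.trans h1))]
    have hs1 : 1 - s ≠ 0 := by intro h; linarith
    have ht1 : 1 - t ≠ 0 := by intro h; linarith
    rcases le_total s t with h | h
    · rw [min_eq_left h]; field_simp; ring
    · rw [min_eq_right h]; field_simp; ring
  have hR : ∫ u, ∫ q, H q u ∂(μ.prod μ) ∂μ =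
      ∫ u in Set.Ioo (0 : ℝ) T, (α T - α u) ^ 2 / (1 - u) ^ 2 := by
    rw [hμ, ← hμ]
    apply setIntegral_congr_fun measurableSet_Ioo
    rintro u ⟨hu0, huT⟩
    simp only
    have e1 : ∀ q : ℝ × ℝ, H q u = (1 / (1 - u) ^ 2) *
        ((Set.Ioi u).indicator (deriv α) q.1 * (Set.Ioi u).indicator (deriv α) q.2) := by
      intro q
      simp only [hH, hS, Set.indicator, Set.mem_ofPred_eq, Set.mem_Ioi]
      by_cases a : u < q.1 <;> by_cases b : u < q.2 <;> simp [a, b]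
      ring
    simp_rw [e1]
    rw [integral_const_mul, integral_prod_mul, integral_indicator measurableSet_Ioi, hμ,
      Measure.restrict_restrict measurableSet_Ioi]
    have e2 : Set.Ioi u ∩ Set.Ioo 0 T = Set.Ioo u T := by
      ext x
      simp only [Set.mem_inter_iff, Set.mem_Ioi, Set.mem_Ioo]
      constructor
      · rintro ⟨a, b, c⟩; exact ⟨a, c⟩
      · rintro ⟨a, c⟩; exact ⟨a, hu0.trans a, c⟩
    have hsub2 : Set.uIcc u T ⊆ Set.Ico 0 1 := by
      rw [Set.uIcc_of_le huT.le]
      exact (Set.Icc_subset_Icc_left hu0.le).trans hsub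
    rw [e2, ← integral_Ioc_eq_integral_Ioo, ← intervalIntegral.integral_of_le huT.le,
      intervalIntegral.integral_eq_sub_of_hasDerivAt
        (fun x hx => (hd x (hsub2 hx)).hasDerivAt) (hd'.mono hsub2).intervalIntegrable]
    ring
  rw [← hL, hswap, hR]

lemma aux_diff (α : ℝ → ℝ)
    (hc : ContinuousOn α (Set.Icc 0 1))
    (hint1 : IntegrableOn (fun s => (α 1 - α s) ^ 2 / (1 - s) ^ 2) (Set.Ioo 0 1) volume)
    (T : ℝ) (h0 : 0 < T) (h1 : T < 1) :
    |(∫ u in Set.Ioo (0 : ℝ) T, (α T - α u) ^ 2 / (1 - u) ^ 2)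
      - ∫ u in Set.Ioo (0 : ℝ) T, (α 1 - α u) ^ 2 / (1 - u) ^ 2| ≤
    √((α 1 - α T) ^ 2 / (1 - T)) * (∫ s in Set.Ioo (0:ℝ) 1, (α 1 - α s) ^ 2 / (1 - s) ^ 2)
     + (√((α 1 - α T) ^ 2 / (1 - T)) + (α 1 - α T) ^ 2 / (1 - T)) := by
  set r := (α 1 - α T) ^ 2 / (1 - T) with hr
  have hT : 0 < 1 - T := by linarith
  have hr0 : 0 ≤ r := by positivity
  have hb : (α 1 - α T) ^ 2 = r * (1 - T) := by rw [hr]; field_simp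
  set δ := √r with hδ
  have hδ0 : 0 ≤ δ := Real.sqrt_nonneg _
  have hδ2 : r = δ ^ 2 := (Real.sq_sqrt hr0).symm
  have hsub : Set.Ioo 0 T ⊆ Set.Ioo (0:ℝ) 1 := Set.Ioo_subset_Ioo_right h1.le
  have hi1 := hint1.mono_set hsub
  have hw := aux_wint T h1
  have hi2 : IntegrableOn (fun u => (α T - α u) ^ 2 / (1 - u) ^ 2) (Set.Ioo 0 T) volume := by
    have : IntegrableOn (fun u => (α T - α u) ^ 2 / (1 - u) ^ 2) (Set.Icc 0 T) volume := by
      apply ContinuousOn.integrableOn_Icc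
      have hc' := hc.mono (Set.Icc_subset_Icc_right h1.le)
      apply ContinuousOn.div (by fun_prop) (by fun_prop)
      intro x hx
      have := hx.2
      apply pow_ne_zero
      intro h
      linarith
    exact this.mono_set Set.Ioo_subset_Icc_self
  rw [← integral_sub hi2 hi1]
  have hmono : ∫ u in Set.Ioo (0 : ℝ) T, (α 1 - α u) ^ 2 / (1 - u) ^ 2 ≤
      ∫ s in Set.Ioo (0:ℝ) 1, (α 1 - α s) ^ 2 / (1 - s) ^ 2 :=
    setIntegral_mono_set hint1 (Filter.Eventually.of_forall fun x => by positivity)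
      hsub.eventuallyLE
  have hbound : ∀ u, ‖(α T - α u) ^ 2 / (1 - u) ^ 2 - (α 1 - α u) ^ 2 / (1 - u) ^ 2‖ ≤
      δ * ((α 1 - α u) ^ 2 / (1 - u) ^ 2) + ((δ + r) * (1 - T)) * (1 / (1 - u) ^ 2) := by
    intro u
    have key : |(α T - α u) ^ 2 - (α 1 - α u) ^ 2| ≤
        δ * (α 1 - α u) ^ 2 + (δ + r) * (1 - T) := by
      set a := α 1 - α u with ha
      set b := α 1 - α T with hb'
      have e : α T - α u = a - b := by rw [ha, hb']; ring
      have hab : 2 * |a * b| ≤ δ * a ^ 2 + δ * (1 - T) := by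
        have : |b| = δ * √(1 - T) := by
          rw [hδ, ← Real.sqrt_mul hr0, ← hb, Real.sqrt_sq_eq_abs]
        rw [abs_mul, this]
        have h3 := Real.sq_sqrt hT.le
        have h4 := sq_abs a
        nlinarith [mul_nonneg hδ0 (sq_nonneg (|a| - √(1 - T)))]
      rw [e]
      have := abs_le.1 (le_refl |a * b|)
      have hb0 := sq_nonneg b
      rw [abs_le]
      constructor <;> nlinarith
    rw [← sub_div, Real.norm_eq_abs, abs_div, abs_of_nonneg (sq_nonneg (1 - u))]
    calc _ ≤ (δ * (α 1 - α u) ^ 2 + (δ + r) * (1 - T)) / (1 - u) ^ 2 := by gcongr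
      _ = _ := by ring
  have := norm_integral_le_of_norm_le
    ((hi1.const_mul δ).add (hw.const_mul ((δ + r) * (1 - T)))) (Filter.Eventually.of_forall hbound)
  rw [← Real.norm_eq_abs]
  refine this.trans ?_
  simp only [Pi.add_apply]
  rw [integral_add (hi1.const_mul δ) (hw.const_mul _), integral_const_mul, integral_const_mul,
    aux_w T h0.le h1]
  have e : (δ + r) * (1 - T) * (1 / (1 - T) - 1) = (δ + r) * T := by field_simp; ring
  rw [e]
  have : (δ + r) * T ≤ δ + r := mul_le_of_le_one_right (by positivity) h1.le
  have := mul_le_mul_of_nonneg_left hmono hδ0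
  linarith




/-- Brownian-bridge covariance double-integral identity (Lemma 3.1): for a weight function
`α` continuous on `[0,1]`, continuously differentiable on `[0,1)`, with
`(α 1 - α s)²/(1-s) → 0` as `s → 1⁻` and the stated integrability conditions,
`∬ α'(s) α'(t) (min(s,t) - st)/((1-s)(1-t)) ds dt = ∫₀¹ (α(1)-α(s))²/(1-s)² ds`,
where `min(s,t) - st` is the covariance of the standard Brownian bridge. -/
theorem stmt6 (α : ℝ → ℝ)
    (hc : ContinuousOn α (Set.Icc 0 1))
    (hd : ∀ s ∈ Set.Ico (0 : ℝ) 1, DifferentiableAt ℝ α s)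
    (hd' : ContinuousOn (deriv α) (Set.Ico 0 1))
    (hlim : Filter.Tendsto (fun s => (α 1 - α s) ^ 2 / (1 - s))
      (nhdsWithin 1 (Set.Iio 1)) (nhds 0))
    (hint1 : IntegrableOn (fun s => (α 1 - α s) ^ 2 / (1 - s) ^ 2) (Set.Ioo 0 1) volume)
    (hint2 : IntegrableOn
      (fun q : ℝ × ℝ =>
        deriv α q.1 * deriv α q.2 * (min q.1 q.2 - q.1 * q.2) / ((1 - q.1) * (1 - q.2)))
      (Set.Ioo 0 1 ×ˢ Set.Ioo 0 1) volume) :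
    ∫ q in Set.Ioo (0 : ℝ) 1 ×ˢ Set.Ioo (0 : ℝ) 1,
        deriv α q.1 * deriv α q.2 * (min q.1 q.2 - q.1 * q.2) / ((1 - q.1) * (1 - q.2))
      = ∫ s in Set.Ioo (0 : ℝ) 1, (α 1 - α s) ^ 2 / (1 - s) ^ 2 := by
  set T : ℕ → ℝ := fun n => 1 - 1 / ((n : ℝ) + 2) with hTdef
  have hT0 : ∀ n, 0 < T n := by
    intro n
    have h : (1:ℝ) < (n:ℝ) + 2 := by have := n.cast_nonneg (α := ℝ); linarith
    have : 1 / ((n : ℝ) + 2) < 1 := by rw [div_lt_one (by linarith)]; exact h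
    simp only [hTdef]; linarith
  have hT1 : ∀ n, T n < 1 := by
    intro n
    have : 0 < 1 / ((n : ℝ) + 2) := by positivity
    simp only [hTdef]; linarith
  have hTm : Monotone T := by
    intro m n h
    simp only [hTdef]
    gcongr
  have hTl : Filter.Tendsto T Filter.atTop (nhds 1) := by
    have h1 : Filter.Tendsto (fun n : ℕ => 1 / ((n : ℝ) + 2)) Filter.atTop (nhds 0) := by
      have : Filter.Tendsto (fun n : ℕ => (n : ℝ) + 2) Filter.atTop Filter.atTop :=
        Filter.tendsto_atTop_add_const_right _ _ tendsto_natCast_atTop_atTop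
      simp only [one_div]
      exact this.inv_tendsto_atTop
    have h2 := h1.const_sub 1
    rw [sub_zero] at h2
    exact h2
  have hTl' : Filter.Tendsto T Filter.atTop (nhdsWithin 1 (Set.Iio 1)) :=
    tendsto_nhdsWithin_iff.2 ⟨hTl, Filter.Eventually.of_forall hT1⟩
  have hex : ∀ x y : ℝ, x < 1 → y < 1 → ∃ n, x < T n ∧ y < T n := fun x y hx hy =>
    ((hTl.eventually (lt_mem_nhds hx)).and (hTl.eventually (lt_mem_nhds hy))).exists
  have hU1 : ⋃ n, Set.Ioo 0 (T n) = Set.Ioo (0:ℝ) 1 := by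
    ext x
    simp only [Set.mem_iUnion, Set.mem_Ioo]
    constructor
    · rintro ⟨n, a, b⟩; exact ⟨a, b.trans (hT1 n)⟩
    · rintro ⟨a, b⟩
      obtain ⟨n, h, -⟩ := hex x x b b
      exact ⟨n, a, h⟩
  have hU2 : ⋃ n, Set.Ioo 0 (T n) ×ˢ Set.Ioo 0 (T n) = Set.Ioo (0:ℝ) 1 ×ˢ Set.Ioo (0:ℝ) 1 := by
    ext ⟨x, y⟩
    simp only [Set.mem_iUnion, Set.mem_Ioo, Set.mem_prod]
    constructor
    · rintro ⟨n, ⟨a, b⟩, c, d⟩; exact ⟨⟨a, b.trans (hT1 n)⟩, c, d.trans (hT1 n)⟩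
    · rintro ⟨⟨a, b⟩, c, d⟩
      obtain ⟨n, h, h'⟩ := hex x y b d
      exact ⟨n, ⟨a, h⟩, c, h'⟩
  have hM1 : Monotone fun n => Set.Ioo 0 (T n) := fun m n h => Set.Ioo_subset_Ioo_right (hTm h)
  have hlimL := tendsto_setIntegral_of_monotone
    (fun n => measurableSet_Ioo.prod measurableSet_Ioo)
    (fun m n h => Set.prod_mono (hM1 h) (hM1 h)) (hU2.symm ▸ hint2)
  have hlimR := tendsto_setIntegral_of_monotone
    (fun n => measurableSet_Ioo) hM1 (hU1.symm ▸ hint1)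
  rw [hU2] at hlimL
  rw [hU1] at hlimR
  have hr : Filter.Tendsto (fun n => (α 1 - α (T n)) ^ 2 / (1 - T n)) Filter.atTop (nhds 0) :=
    hlim.comp hTl'
  have hs : Filter.Tendsto (fun n => √((α 1 - α (T n)) ^ 2 / (1 - T n))) Filter.atTop (nhds 0) := by
    have := (Real.continuous_sqrt.tendsto 0).comp hr
    rw [Real.sqrt_zero] at this
    exact this
  have hB := (hs.mul_const (∫ s in Set.Ioo (0:ℝ) 1, (α 1 - α s) ^ 2 / (1 - s) ^ 2)).add (hs.add hr)
  simp only [zero_mul, add_zero] at hB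
  have hD := squeeze_zero_norm (f := fun n =>
    (∫ u in Set.Ioo (0 : ℝ) (T n), (α (T n) - α u) ^ 2 / (1 - u) ^ 2)
      - ∫ u in Set.Ioo (0 : ℝ) (T n), (α 1 - α u) ^ 2 / (1 - u) ^ 2) (fun n => aux_diff α hc hint1 (T n) (hT0 n) (hT1 n)) hB
  have hE := hD.add hlimR
  simp only [sub_add_cancel, zero_add] at hE
  refine tendsto_nhds_unique hlimL (hE.congr fun n => ?_)
  exact (aux_T α hd hd' (T n) (hT0 n) (hT1 n)).symm
end
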